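/- If the hiding distribution h on Q is monotone, then h is strongly simply searchable: both depth-first searches S⁺ and S⁻ are optimal for h, and every search that is optimal for h coincides with S⁺ on [0, 2λ₁ + λ₂] or with S⁻ on [0, 2λ₂ + λ₁]. -/

import Mathlib

open MeasureTheory Set Filter
open scoped ENNReal

noncomputable section

/-- A search of the interval network `Q = [-l₂, l₁]` with root `0`:
a 1-Lipschitz function on `[0,∞)` taking values in `Q` and starting at the root. -/
def IsSearch (l₁ l₂ : ℝ) (S : ℝ → ℝ) : Prop :=
  S 0 = 0 ∧ (∀ t, 0 ≤ t → S t ∈ Icc (-l₂) l₁) ∧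
    (∀ s t, 0 ≤ s → 0 ≤ t → |S s - S t| ≤ |s - t|)

/-- The search time `T(S,x) = inf {t ≥ 0 : S t = x}`, with value `∞` if `x` is never reached. -/
def searchTime (S : ℝ → ℝ) (x : ℝ) : ℝ≥0∞ :=
  sInf (ENNReal.ofReal '' {t : ℝ | 0 ≤ t ∧ S t = x})

/-- The expected search time `T(S,h) = ∫_Q T(S,x) dh(x)`. -/
def expTime (S : ℝ → ℝ) (h : Measure ℝ) : ℝ≥0∞ :=
  ∫⁻ x, searchTime S x ∂h


/-- The depth-first search `S⁺`: unit speed from `0` to `l₁`, then to `-l₂`, then rests. -/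
def Splus (l₁ l₂ : ℝ) (t : ℝ) : ℝ :=
  if t ≤ l₁ then t else if t ≤ 2 * l₁ + l₂ then 2 * l₁ - t else -l₂

/-- The depth-first search `S⁻`: unit speed from `0` to `-l₂`, then to `l₁`, then rests. -/
def Sminus (l₁ l₂ : ℝ) (t : ℝ) : ℝ :=
  if t ≤ l₂ then -t else if t ≤ 2 * l₂ + l₁ then t - 2 * l₂ else l₁

/-- A hiding distribution is balanced if the two branches at the root have equal search
density: `λ₂ · h((0,λ₁]) = λ₁ · h([-λ₂,0))`. -/
def BalancedDist (l₁ l₂ : ℝ) (h : Measure ℝ) : Prop :=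
  l₂ * (h (Ioc 0 l₁)).toReal = l₁ * (h (Ico (-l₂) 0)).toReal

/-- A hiding distribution on `Q = [-l₂, l₁]` is monotone if branch density is
nondecreasing away from the root along each arc, and at least the overall density
`1/μ` everywhere. -/
def MonotoneDist (l₁ l₂ : ℝ) (h : Measure ℝ) : Prop :=
  (∀ x y : ℝ, 0 < x → x ≤ y → y < l₁ →
    (h (Icc x l₁)).toReal / (l₁ - x) ≤ (h (Icc y l₁)).toReal / (l₁ - y)) ∧
  (∀ x y : ℝ, 0 < x → x ≤ y → y < l₂ →
    (h (Icc (-l₂) (-x))).toReal / (l₂ - x) ≤ (h (Icc (-l₂) (-y))).toReal / (l₂ - y)) ∧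
  (∀ x : ℝ, 0 < x → x < l₁ → 1 / (l₁ + l₂) ≤ (h (Icc x l₁)).toReal / (l₁ - x)) ∧
  (∀ x : ℝ, 0 < x → x < l₂ → 1 / (l₁ + l₂) ≤ (h (Icc (-l₂) (-x))).toReal / (l₂ - x))

/-- A search time bounded by `t` is realised arbitrarily closely by actual visits. -/
theorem exists_visit_of_searchTime_lt {S : ℝ → ℝ} {x t : ℝ}
    (hx : searchTime S x < ENNReal.ofReal t) : ∃ s, 0 ≤ s ∧ s < t ∧ S s = x := by
  obtain ⟨_, ⟨s, ⟨hs, hsx⟩, rfl⟩, hlt⟩ := sInf_lt_iff.1 hx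
  exact ⟨s, hs, (ENNReal.ofReal_lt_ofReal_iff_of_nonneg hs).1 hlt, hsx⟩

theorem searchTime_le {S : ℝ → ℝ} {x t : ℝ} (ht : 0 ≤ t) (h : S t = x) :
    searchTime S x ≤ ENNReal.ofReal t :=
  sInf_le ⟨t, ⟨ht, h⟩, rfl⟩

theorem searchTime_neg (S : ℝ → ℝ) (x : ℝ) :
    searchTime (fun t => -S t) x = searchTime S (-x) := by
  simp only [searchTime, neg_eq_iff_eq_neg]

namespace IsSearch

variable {l₁ l₂ : ℝ} {S : ℝ → ℝ}

theorem neg (hS : IsSearch l₁ l₂ S) : IsSearch l₂ l₁ fun t => -S t := by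
  obtain ⟨h0, hI, hL⟩ := hS
  refine ⟨by simp [h0], fun t ht => ?_, fun s t hs ht => ?_⟩
  · have := hI t ht
    exact ⟨by linarith [this.2], by linarith [this.1]⟩
  · rw [← neg_sub', abs_neg]
    exact hL s t hs ht

theorem continuousOn (hS : IsSearch l₁ l₂ S) : ContinuousOn S (Ici 0) := by
  refine LipschitzOnWith.continuousOn (K := 1) (LipschitzOnWith.of_dist_le_mul ?_)
  intro s hs t ht
  simpa [Real.dist_eq] using hS.2.2 s t hs ht

theorem abs_le (hS : IsSearch l₁ l₂ S) {t : ℝ} (ht : 0 ≤ t) : |S t| ≤ t := by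
  simpa [hS.1, abs_of_nonneg ht] using hS.2.2 t 0 ht le_rfl

/-- A point on the positive arc is found no later than any point beyond it. -/
theorem searchTime_mono (hS : IsSearch l₁ l₂ S) {x y : ℝ} (hx : 0 ≤ x) (hxy : x ≤ y) :
    searchTime S x ≤ searchTime S y := by
  refine le_sInf ?_
  rintro _ ⟨t, ⟨ht, hty⟩, rfl⟩
  have hc : ContinuousOn S (Icc 0 t) := hS.continuousOn.mono fun s hs => hs.1
  obtain ⟨s, hs, hsx⟩ := intermediate_value_Icc ht hc
    (show x ∈ Icc (S 0) (S t) from ⟨by rw [hS.1]; exact hx, by rw [hty]; exact hxy⟩)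
  exact (searchTime_le hs.1 hsx).trans (ENNReal.ofReal_le_ofReal hs.2)

theorem searchTime_zero (hS : IsSearch l₁ l₂ S) : searchTime S 0 = 0 := by
  simpa using searchTime_le le_rfl hS.1

/-- A finite search time is attained. -/
theorem apply_of_searchTime_eq (hS : IsSearch l₁ l₂ S) {x r : ℝ} (hr : 0 ≤ r)
    (h : searchTime S x = ENNReal.ofReal r) : S r = x := by
  refine eq_of_abs_sub_le_all fun ε hε => ?_
  obtain ⟨t, ht, htr, htx⟩ := exists_visit_of_searchTime_lt (S := S) (x := x) (t := r + ε)
    (by rw [h]; exact (ENNReal.ofReal_lt_ofReal_iff (by linarith)).2 (by linarith))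
  have hrt : r ≤ t := by
    have := searchTime_le ht htx
    rwa [h, ENNReal.ofReal_le_ofReal_iff ht] at this
  have := hS.2.2 r t hr ht
  rw [htx, abs_of_nonpos (sub_nonpos.2 hrt)] at this
  linarith

/-- If a point of the negative arc is reached at time `t`, every point of the positive arc
whose search time is at most `t` has been visited before. -/
theorem exists_visit_le (hS : IsSearch l₁ l₂ S) {x y t : ℝ} (hx : 0 < x) (hy : 0 ≤ y)
    (ht : 0 ≤ t) (hty : S t = -y) (h : searchTime S x ≤ ENNReal.ofReal t) :
    ∃ s, 0 ≤ s ∧ s ≤ t ∧ S s = x := by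
  obtain ⟨s, hs, hst, hsx⟩ := exists_visit_of_searchTime_lt (S := S) (x := x) (t := t + x)
    (h.trans_lt ((ENNReal.ofReal_lt_ofReal_iff (by linarith)).2 (by linarith)))
  refine ⟨s, hs, ?_, hsx⟩
  by_contra! hlt
  have := hS.2.2 s t hs ht
  rw [hsx, hty, abs_of_pos (sub_pos.2 hlt)] at this
  linarith [le_abs_self (x - -y)]

/-- Reaching `-y` after `x` takes at least the time `2 x + y`. -/
theorem le_of_visit (hS : IsSearch l₁ l₂ S) {x y s t : ℝ} (hs : 0 ≤ s) (hst : s ≤ t)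
    (hsx : S s = x) (hty : S t = -y) : x ≤ s ∧ s + x + y ≤ t := by
  have h1 := (le_abs_self _).trans (hS.abs_le hs)
  have h2 := (neg_le_abs _).trans (hS.2.2 t s (hs.trans hst) hs)
  rw [abs_of_nonneg (sub_nonneg.2 hst)] at h2
  constructor <;> linarith

/-- The search time of `-y` exceeds `y` by at least twice the measure of any set of points
of the positive arc that are found no later than `-y`. -/
theorem add_volume_le_searchTime (hS : IsSearch l₁ l₂ S) {y : ℝ} (hy : 0 ≤ y) {U : Set ℝ}
    (hU : ∀ x ∈ U, 0 < x ∧ searchTime S x ≤ searchTime S (-y)) :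
    ENNReal.ofReal y + 2 * volume U ≤ searchTime S (-y) := by
  refine le_sInf ?_
  rintro _ ⟨t, ⟨ht, hty⟩, rfl⟩
  have hyt : y ≤ t := by
    have := (neg_le_abs _).trans (hS.abs_le ht)
    linarith
  have hsub : U ⊆ Icc 0 ((t - y) / 2) := fun x hx => by
    obtain ⟨hx0, hxy⟩ := hU x hx
    obtain ⟨s, hs, hst, hsx⟩ := hS.exists_visit_le hx0 hy ht hty
      (hxy.trans (searchTime_le ht hty))
    have := hS.le_of_visit hs hst hsx hty
    exact ⟨hx0.le, by linarith⟩
  calc ENNReal.ofReal y + 2 * volume U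
      ≤ ENNReal.ofReal y + ENNReal.ofReal 2 * ENNReal.ofReal ((t - y) / 2) := by
        gcongr
        · simp
        · simpa using measure_mono (μ := volume) hsub
    _ = ENNReal.ofReal t := by
        rw [← ENNReal.ofReal_mul (by norm_num), ← ENNReal.ofReal_add hy (by linarith)]
        congr 1
        ring

/-- A search that reaches `-y` at time `2 a + y`, having already visited all of `(0, a)`,
goes to `a` at full speed. -/
theorem apply_of_visits (hS : IsSearch l₁ l₂ S) {a y : ℝ} (ha : 0 < a)
    (hty : S (2 * a + y) = -y)
    (hv : ∀ x ∈ Ioo 0 a, ∃ s, 0 ≤ s ∧ s ≤ 2 * a + y ∧ S s = x) : S a = a := by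
  refine eq_of_abs_sub_le_all fun ε hε => ?_
  have hx : max (a / 2) (a - ε / 2) ∈ Ioo 0 a :=
    ⟨lt_max_of_lt_left (by linarith), max_lt (by linarith) (by linarith)⟩
  have hxε := le_max_right (a / 2) (a - ε / 2)
  set x := max (a / 2) (a - ε / 2)
  obtain ⟨s, hs, hst, hsx⟩ := hv x hx
  obtain ⟨h1, h2⟩ := hS.le_of_visit hs hst hsx hty
  have h3 := hS.2.2 a s ha.le hs
  have h4 : |a - s| ≤ a - x := abs_sub_le_iff.2 ⟨by linarith, by linarith⟩
  calc |S a - a| = |(S a - S s) - (a - x)| := by rw [hsx]; congr 1; ring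
    _ ≤ |S a - S s| + |a - x| := abs_sub _ _
    _ ≤ ε := by rw [abs_of_pos (sub_pos.2 hx.2)]; linarith

/-- A search that is at `a` at time `a` has moved there at unit speed. -/
theorem apply_eq_of_le (hS : IsSearch l₁ l₂ S) {a t : ℝ} (hSa : S a = a) (ht : 0 ≤ t)
    (hta : t ≤ a) : S t = t := by
  have h1 := (le_abs_self _).trans (hS.abs_le ht)
  have h2 := (le_abs_self _).trans (hS.2.2 a t (ht.trans hta) ht)
  rw [abs_of_nonneg (sub_nonneg.2 hta)] at h2
  linarith

theorem eq_Splus (hS : IsSearch l₁ l₂ S) (hl₁ : 0 < l₁) (h₁ : S l₁ = l₁)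
    (h₂ : S (2 * l₁ + l₂) = -l₂) :
    ∀ t ∈ Icc (0 : ℝ) (2 * l₁ + l₂), S t = Splus l₁ l₂ t := by
  rintro t ⟨ht0, ht⟩
  unfold Splus
  split_ifs with hlt
  · exact hS.apply_eq_of_le h₁ ht0 hlt
  · push Not at hlt
    have h3 := (le_abs_self _).trans (hS.2.2 l₁ t hl₁.le ht0)
    have h4 := (le_abs_self _).trans (hS.2.2 t (2 * l₁ + l₂) ht0 (ht0.trans ht))
    rw [abs_of_nonpos (by linarith)] at h3 h4
    linarith

/-- If a search comes arbitrarily close to the depth-first turning points, it is the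
depth-first search `S⁺`. -/
theorem eq_Splus_of_approx (hS : IsSearch l₁ l₂ S) (hl₁ : 0 < l₁) (hl₂ : 0 < l₂)
    (happ : ∀ ε > 0, ∃ a y, l₁ - ε ≤ a ∧ l₂ - ε ≤ y ∧ 0 < a ∧ 0 < y ∧
      S a = a ∧ S (2 * a + y) = -y) :
    ∀ t ∈ Icc (0 : ℝ) (2 * l₁ + l₂), S t = Splus l₁ l₂ t := by
  refine hS.eq_Splus hl₁ ?_ ?_ <;> refine eq_of_abs_sub_le_all fun ε hε => ?_ <;>
    obtain ⟨a, y, ha, hy, ha0, hy0, hSa, hSy⟩ := happ (ε / 6) (by linarith) <;>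
    have hal := (hS.2.1 a ha0.le).2 <;>
    have hyl := (hS.2.1 (2 * a + y) (by linarith)).1 <;>
    rw [hSa] at hal <;> rw [hSy] at hyl
  · have h := hS.2.2 l₁ a hl₁.le ha0.le
    rw [hSa, abs_of_nonneg (sub_nonneg.2 hal)] at h
    obtain ⟨h1, h2⟩ := abs_sub_le_iff.1 h
    exact abs_sub_le_iff.2 ⟨by linarith, by linarith⟩
  · have h := hS.2.2 (2 * l₁ + l₂) (2 * a + y) (by linarith) (by linarith)
    rw [hSy, abs_of_nonneg (by linarith : 0 ≤ 2 * l₁ + l₂ - (2 * a + y))] at h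
    obtain ⟨h1, h2⟩ := abs_sub_le_iff.1 h
    exact abs_sub_le_iff.2 ⟨by linarith, by linarith⟩

/-- If the lower bound for the search time of `-y` is attained, then the search goes straight to
the turning point `a` and from there straight to `-y`. -/
theorem exists_turn (hS : IsSearch l₁ l₂ S) {y : ℝ} (hy : 0 < y) {U : Set ℝ}
    (hUl : ∀ x ∈ U, x ≤ l₁) (hU0 : ∀ x ∈ U, 0 < x)
    (hU : ∀ x ∈ U, searchTime S x ≤ searchTime S (-y))
    (hlow : ∀ x ∈ U, ∀ z, 0 < z → z ≤ x → z ∈ U)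
    (heq : searchTime S (-y) = ENNReal.ofReal y + 2 * volume U) {x : ℝ} (hx : x ∈ U) :
    ∃ a, x ≤ a ∧ S a = a ∧ S (2 * a + y) = -y := by
  have hfin : volume U ≠ ⊤ := measure_ne_top_of_subset
    (show U ⊆ Ioc 0 l₁ from fun z hz => ⟨hU0 z hz, hUl z hz⟩) (by simp)
  obtain ⟨a, ha0, ha⟩ : ∃ a : ℝ, 0 ≤ a ∧ volume U = ENNReal.ofReal a :=
    ⟨(volume U).toReal, ENNReal.toReal_nonneg, (ENNReal.ofReal_toReal hfin).symm⟩
  have hT : searchTime S (-y) = ENNReal.ofReal (2 * a + y) := by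
    rw [heq, ha, add_comm, ENNReal.ofReal_add (by linarith) hy.le,
      ENNReal.ofReal_mul (by norm_num), ENNReal.ofReal_ofNat]
  have hxa : x ≤ a := by
    have : volume (Ioc 0 x) ≤ volume U := measure_mono fun z hz => hlow x hx z hz.1 hz.2
    rw [ha, Real.volume_Ioc, sub_zero] at this
    exact (ENNReal.ofReal_le_ofReal_iff ha0).1 this
  have hty := hS.apply_of_searchTime_eq (by linarith) hT
  have hapos := (hU0 x hx).trans_le hxa
  refine ⟨a, hxa, hS.apply_of_visits hapos hty fun z hz => ?_, hty⟩
  refine hS.exists_visit_le hz.1 hy.le (by linarith) hty (hT ▸ hU z ?_)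
  by_contra hzU
  have : volume U ≤ volume (Ioc 0 z) := measure_mono fun w hw =>
    ⟨hU0 w hw, le_of_not_gt fun hzw => hzU (hlow w hw z hz.1 hzw.le)⟩
  rw [ha, Real.volume_Ioc, sub_zero, ENNReal.ofReal_le_ofReal_iff hz.1.le] at this
  exact absurd hz.2 this.not_gt

end IsSearch

theorem isSearch_Splus {l₁ l₂ : ℝ} (hl₁ : 0 < l₁) (hl₂ : 0 < l₂) :
    IsSearch l₁ l₂ (Splus l₁ l₂) := by
  refine ⟨by simp [Splus, hl₁.le], fun t ht => ?_, fun s t hs ht => ?_⟩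
  · unfold Splus
    split_ifs <;> constructor <;> linarith
  · unfold Splus
    rw [abs_le]
    constructor <;> split_ifs <;>
      first | linarith [le_abs_self (s - t)] | linarith [neg_abs_le (s - t)] |
        linarith [abs_nonneg (s - t)]

/-- A measure on `(0, l]` whose tails dominate those of `c` times Lebesgue measure dominates it
on all upper sets. -/
theorem mul_volume_le_of_isUpperSet {l c : ℝ} (hc : 0 ≤ c) {ν : Measure ℝ}
    (hν : ∀ x, 0 < x → x < l → ENNReal.ofReal (c * (l - x)) ≤ ν (Icc x l))
    {U : Set ℝ} (hU : IsUpperSet U) :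
    ENNReal.ofReal c * volume.restrict (Ioc 0 l) U ≤ ν.restrict (Ioc 0 l) U := by
  have hm : MeasurableSet U := hU.ordConnected.measurableSet
  rw [Measure.restrict_apply hm, Measure.restrict_apply hm]
  rcases (U ∩ Ioc 0 l).eq_empty_or_nonempty with he | hne
  · simp [he]
  have hbdd : BddBelow (U ∩ Ioc 0 l) := ⟨0, fun x hx => hx.2.1.le⟩
  set s := sInf (U ∩ Ioc 0 l)
  have hs0 : 0 ≤ s := le_csInf hne fun x hx => hx.2.1.le
  have hsub : U ∩ Ioc 0 l ⊆ Icc s l := fun x hx => ⟨csInf_le hbdd hx, hx.2.2⟩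
  have htail : ∀ x ∈ Ioo s l, ENNReal.ofReal (c * (l - x)) ≤ ν (U ∩ Ioc 0 l) := by
    rintro x ⟨hsx, hxl⟩
    obtain ⟨z, hz, hzx⟩ := exists_lt_of_csInf_lt hne hsx
    refine (hν x (hs0.trans_lt hsx) hxl).trans (measure_mono fun w hw => ?_)
    exact ⟨hU (hzx.le.trans hw.1) hz.1, (hs0.trans_lt hsx).trans_le hw.1, hw.2⟩
  have hlim : ENNReal.ofReal (c * (l - s)) ≤ ν (U ∩ Ioc 0 l) := by
    rcases le_or_gt l s with hls | hsl
    · rw [ENNReal.ofReal_of_nonpos (mul_nonpos_of_nonneg_of_nonpos hc (by linarith))]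
      exact zero_le
    · have hcont : Continuous fun x => ENNReal.ofReal (c * (l - x)) :=
        ENNReal.continuous_ofReal.comp (by fun_prop)
      refine le_of_tendsto (hcont.continuousWithinAt (s := Ioi s) (x := s)) ?_
      filter_upwards [Ioo_mem_nhdsGT hsl] with x hx using htail x hx
  calc ENNReal.ofReal c * volume (U ∩ Ioc 0 l)
      ≤ ENNReal.ofReal c * ENNReal.ofReal (l - s) := by
        gcongr
        simpa using measure_mono (μ := volume) hsub
    _ = ENNReal.ofReal (c * (l - s)) := (ENNReal.ofReal_mul hc).symm
    _ ≤ _ := hlim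

/-- For measures dominating `c • m₁`, `c • m₂` on upper sets and monotone arrival times
`A`, `B`, the expected waiting caused by the order of arrival is at least `c m₁(ℝ) m₂(ℝ)`. -/
theorem mul_le_lintegral_add_lintegral {ν₁ ν₂ m₁ m₂ : Measure ℝ} [IsFiniteMeasure ν₁]
    [IsFiniteMeasure ν₂] [IsFiniteMeasure m₁] [IsFiniteMeasure m₂] {c : ℝ≥0∞}
    (h₁ : ∀ U, IsUpperSet U → c * m₁ U ≤ ν₁ U) (h₂ : ∀ U, IsUpperSet U → c * m₂ U ≤ ν₂ U)
    {A B : ℝ → ℝ≥0∞} (hA : Monotone A) (hB : Monotone B) :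
    c * (m₁ univ * m₂ univ) ≤
      ∫⁻ x, m₂ {y | B y < A x} ∂ν₁ + ∫⁻ y, m₁ {x | A x ≤ B y} ∂ν₂ := by
  set R : Set (ℝ × ℝ) := {p | A p.1 ≤ B p.2}
  have hR : MeasurableSet R :=
    measurableSet_le (hA.measurable.comp measurable_fst) (hB.measurable.comp measurable_snd)
  have e₁ : ∫⁻ x, m₂ {y | B y < A x} ∂ν₁ = ν₁.prod m₂ Rᶜ := by
    rw [Measure.prod_apply hR.compl]
    simp [R, Set.preimage, Set.compl_def]
  have e₂ : ∫⁻ y, m₁ {x | A x ≤ B y} ∂ν₂ = m₁.prod ν₂ R := by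
    rw [Measure.prod_apply_symm hR]
    rfl
  have i₁ : c * m₁.prod m₂ Rᶜ ≤ ν₁.prod m₂ Rᶜ := by
    rw [Measure.prod_apply_symm hR.compl, Measure.prod_apply_symm hR.compl,
      ← lintegral_const_mul _ (measurable_measure_prodMk_right hR.compl)]
    refine lintegral_mono fun y => h₁ _ fun x z hxz hx => ?_
    simp only [R, mem_preimage, mem_compl_iff, mem_ofPred_eq, not_le] at hx ⊢
    exact hx.trans_le (hA hxz)
  have i₂ : c * m₁.prod m₂ R ≤ m₁.prod ν₂ R := by
    rw [Measure.prod_apply hR, Measure.prod_apply hR,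
      ← lintegral_const_mul _ (measurable_measure_prodMk_left hR)]
    refine lintegral_mono fun x => h₂ _ fun y z hyz hy => ?_
    exact le_trans (show A x ≤ B y from hy) (hB hyz)
  calc c * (m₁ univ * m₂ univ) = c * m₁.prod m₂ Rᶜ + c * m₁.prod m₂ R := by
        rw [← mul_add, add_comm, measure_add_measure_compl hR, ← univ_prod_univ,
          Measure.prod_prod]
    _ ≤ _ := by rw [e₁, e₂]; gcongr

/-- The search time along the positive arc, extended by zero to the negative half-line. -/
def arcTime (S : ℝ → ℝ) (x : ℝ) : ℝ≥0∞ :=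
  searchTime S (max x 0)

theorem arcTime_of_nonneg (S : ℝ → ℝ) {x : ℝ} (hx : 0 ≤ x) : arcTime S x = searchTime S x := by
  rw [arcTime, max_eq_left hx]

theorem arcTime_neg (S : ℝ → ℝ) {x : ℝ} (hx : 0 ≤ x) :
    arcTime (fun t => -S t) x = searchTime S (-x) := by
  rw [arcTime_of_nonneg _ hx, searchTime_neg]

namespace IsSearch

variable {l₁ l₂ : ℝ} {S : ℝ → ℝ}

theorem monotone_arcTime (hS : IsSearch l₁ l₂ S) : Monotone (arcTime S) := fun _ _ hxy =>
  hS.searchTime_mono (le_max_right _ _) (max_le_max_right _ hxy)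

theorem add_volume_le_arcTime_neg (hS : IsSearch l₁ l₂ S) {y : ℝ} (hy : 0 ≤ y) {U : Set ℝ}
    (hlow : IsLowerSet U) (hU : ∀ x ∈ U, arcTime S x ≤ arcTime (fun t => -S t) y) :
    ENNReal.ofReal y + 2 * volume.restrict (Ioc 0 l₁) U ≤ arcTime (fun t => -S t) y := by
  rw [Measure.restrict_apply hlow.ordConnected.measurableSet, arcTime_neg S hy]
  refine hS.add_volume_le_searchTime hy fun x hx => ⟨hx.2.1, ?_⟩
  simpa only [arcTime_of_nonneg S hx.2.1.le, arcTime_neg S hy] using hU x hx.1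

theorem add_volume_le_arcTime (hS : IsSearch l₁ l₂ S) {x : ℝ} (hx : 0 ≤ x) {U : Set ℝ}
    (hlow : IsLowerSet U) (hU : ∀ y ∈ U, arcTime (fun t => -S t) y ≤ arcTime S x) :
    ENNReal.ofReal x + 2 * volume.restrict (Ioc 0 l₂) U ≤ arcTime S x := by
  simpa using hS.neg.add_volume_le_arcTime_neg hx hlow (by simpa using hU)

theorem exists_turn_of_arcTime_eq (hS : IsSearch l₁ l₂ S) {x y : ℝ} (hx : x ∈ Ioc 0 l₁)
    (hy : 0 < y) {U : Set ℝ} (hlow : IsLowerSet U)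
    (hU : ∀ x ∈ U, arcTime S x ≤ arcTime (fun t => -S t) y) (hxU : x ∈ U)
    (heq : arcTime (fun t => -S t) y =
      ENNReal.ofReal y + 2 * volume.restrict (Ioc 0 l₁) U) :
    ∃ a, x ≤ a ∧ S a = a ∧ S (2 * a + y) = -y := by
  rw [Measure.restrict_apply hlow.ordConnected.measurableSet, arcTime_neg S hy.le] at heq
  refine hS.exists_turn (U := U ∩ Ioc 0 l₁) hy (fun z hz => hz.2.2) (fun z hz => hz.2.1)
    (fun z hz => ?_) (fun z hz w hw hwz => ⟨hlow hwz hz.1, hw, hwz.trans hz.2.2⟩) heq ⟨hxU, hx⟩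
  simpa only [arcTime_of_nonneg S hz.2.1.le, arcTime_neg S hy.le] using hU z hz.1

/-- The expected search time splits into the contributions of the two arcs. -/
theorem expTime_eq (hS : IsSearch l₁ l₂ S) (hl₁ : 0 < l₁) (hl₂ : 0 < l₂) {h : Measure ℝ}
    [IsProbabilityMeasure h] (hsupp : h (Icc (-l₂) l₁) = 1) :
    expTime S h = ∫⁻ x in Ioc 0 l₁, arcTime S x ∂h +
      ∫⁻ y in Ioc 0 l₂, arcTime (fun t => -S t) y ∂h.map Neg.neg := by
  have hres : h.restrict (Icc (-l₂) l₁) = h :=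
    Measure.restrict_eq_self_of_ae_mem ((prob_compl_eq_zero_iff measurableSet_Icc).2 hsupp)
  have hsplit : Icc (-l₂) l₁ = Ico (-l₂) 0 ∪ ({0} ∪ Ioc 0 l₁) := by
    rw [singleton_union, Ioc_insert_left hl₁.le, Ico_union_Icc_eq_Icc (by linarith) hl₁.le]
  have hpos : ∫⁻ x in Ioc 0 l₁, searchTime S x ∂h = ∫⁻ x in Ioc 0 l₁, arcTime S x ∂h :=
    setLIntegral_congr_fun measurableSet_Ioc fun x hx => (arcTime_of_nonneg S hx.1.le).symm
  have hneg : ∫⁻ y in Ioc 0 l₂, arcTime (fun t => -S t) y ∂h.map Neg.neg =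
      ∫⁻ x in Ico (-l₂) 0, searchTime S x ∂h := by
    rw [setLIntegral_map measurableSet_Ioc hS.neg.monotone_arcTime.measurable measurable_neg]
    have : Neg.neg ⁻¹' Ioc 0 l₂ = Ico (-l₂) 0 := by simp
    rw [this]
    refine setLIntegral_congr_fun measurableSet_Ico fun x hx => ?_
    simp only [arcTime_neg S (neg_nonneg.2 hx.2.le), neg_neg]
  have hrestrict : expTime S h = ∫⁻ x in Icc (-l₂) l₁, searchTime S x ∂h := by rw [hres, expTime]
  rw [hrestrict, hsplit, lintegral_union ((measurableSet_singleton _).union measurableSet_Ioc),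
    lintegral_union measurableSet_Ioc, hpos, hneg]
  · simp [hS.searchTime_zero, add_comm]
  · simp
  · rw [Set.disjoint_left]
    rintro x hx (rfl | hx')
    exacts [lt_irrefl _ hx.2, lt_asymm hx.2 hx'.1]

end IsSearch

/-- The expected search time of the depth-first searches. -/
def depthFirstValue (l₁ l₂ : ℝ) (h : Measure ℝ) : ℝ≥0∞ :=
  ∫⁻ x in Ioc 0 l₁, ENNReal.ofReal x ∂h + ∫⁻ y in Ioc 0 l₂, ENNReal.ofReal y ∂h.map Neg.neg +
    2 * (ENNReal.ofReal (1 / (l₁ + l₂)) * (ENNReal.ofReal l₁ * ENNReal.ofReal l₂))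

theorem setLIntegral_ofReal_ne_top {l : ℝ} {ν : Measure ℝ} [IsFiniteMeasure ν] :
    ∫⁻ x in Ioc 0 l, ENNReal.ofReal x ∂ν ≠ ⊤ := by
  refine ne_top_of_le_ne_top (b := ENNReal.ofReal l * ν (Ioc 0 l)) ?_ ?_
  · exact ENNReal.mul_ne_top ENNReal.ofReal_ne_top (measure_ne_top _ _)
  · rw [← setLIntegral_const]
    exact setLIntegral_mono measurable_const fun x hx => ENNReal.ofReal_le_ofReal hx.2

theorem depthFirstValue_ne_top (l₁ l₂ : ℝ) (h : Measure ℝ) [IsProbabilityMeasure h] :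
    depthFirstValue l₁ l₂ h ≠ ⊤ := by
  have : IsFiniteMeasure (h.map Neg.neg) := inferInstance
  simp [depthFirstValue, setLIntegral_ofReal_ne_top, ENNReal.mul_eq_top]

namespace MonotoneDist

variable {l₁ l₂ : ℝ} {h : Measure ℝ} [IsProbabilityMeasure h]

theorem le_measure_Icc (hmono : MonotoneDist l₁ l₂ h) (x : ℝ) (hx : 0 < x) (hxl : x < l₁) :
    ENNReal.ofReal (1 / (l₁ + l₂) * (l₁ - x)) ≤ h (Icc x l₁) := by
  rw [ENNReal.ofReal_le_iff_le_toReal (measure_ne_top _ _)]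
  exact (le_div_iff₀ (sub_pos.2 hxl)).1 (hmono.2.2.1 x hx hxl)

theorem le_map_neg_measure_Icc (hmono : MonotoneDist l₁ l₂ h) (y : ℝ) (hy : 0 < y)
    (hyl : y < l₂) :
    ENNReal.ofReal (1 / (l₁ + l₂) * (l₂ - y)) ≤ h.map Neg.neg (Icc y l₂) := by
  have : Neg.neg ⁻¹' Icc y l₂ = Icc (-l₂) (-y) := by simp
  rw [Measure.map_apply measurable_neg measurableSet_Icc, this,
    ENNReal.ofReal_le_iff_le_toReal (measure_ne_top _ _)]
  exact (le_div_iff₀ (sub_pos.2 hyl)).1 (hmono.2.2.2 y hy hyl)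

theorem mul_volume_le (hmono : MonotoneDist l₁ l₂ h) (hl₁ : 0 < l₁) (hl₂ : 0 < l₂) {U : Set ℝ}
    (hU : IsUpperSet U) :
    ENNReal.ofReal (1 / (l₁ + l₂)) * volume.restrict (Ioc 0 l₁) U ≤ h.restrict (Ioc 0 l₁) U :=
  mul_volume_le_of_isUpperSet (by positivity) hmono.le_measure_Icc hU

theorem mul_volume_le_map_neg (hmono : MonotoneDist l₁ l₂ h) (hl₁ : 0 < l₁) (hl₂ : 0 < l₂)
    {U : Set ℝ} (hU : IsUpperSet U) :
    ENNReal.ofReal (1 / (l₁ + l₂)) * volume.restrict (Ioc 0 l₂) U ≤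
      (h.map Neg.neg).restrict (Ioc 0 l₂) U :=
  mul_volume_le_of_isUpperSet (by positivity) hmono.le_map_neg_measure_Icc hU

/-- A monotone distribution is balanced: each arc carries mass proportional to its length. -/
theorem measure_arc_le (hmono : MonotoneDist l₁ l₂ h) (hl₁ : 0 < l₁) (hl₂ : 0 < l₂) :
    h (Ioc 0 l₁) ≤ ENNReal.ofReal (1 / (l₁ + l₂)) * ENNReal.ofReal l₁ ∧
      h.map Neg.neg (Ioc 0 l₂) ≤ ENNReal.ofReal (1 / (l₁ + l₂)) * ENNReal.ofReal l₂ := by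
  have h₁ := hmono.mul_volume_le hl₁ hl₂ isUpperSet_univ
  have h₂ := hmono.mul_volume_le_map_neg hl₁ hl₂ isUpperSet_univ
  simp only [Measure.restrict_apply_univ, Real.volume_Ioc, sub_zero] at h₁ h₂
  have hdisj : Disjoint (Ioc 0 l₁) (Neg.neg ⁻¹' Ioc 0 l₂) := by
    rw [Set.disjoint_left]
    rintro x hx hx'
    have : 0 < -x := hx'.1
    linarith [hx.1]
  have hsum : h (Ioc 0 l₁) + h.map Neg.neg (Ioc 0 l₂) ≤
      ENNReal.ofReal (1 / (l₁ + l₂)) * ENNReal.ofReal l₁ +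
        ENNReal.ofReal (1 / (l₁ + l₂)) * ENNReal.ofReal l₂ := by
    rw [Measure.map_apply measurable_neg measurableSet_Ioc,
      ← measure_union hdisj (measurable_neg measurableSet_Ioc), ← mul_add,
      ← ENNReal.ofReal_add hl₁.le hl₂.le, ← ENNReal.ofReal_mul (by positivity),
      one_div_mul_cancel (by positivity), ENNReal.ofReal_one]
    exact prob_le_one
  constructor
  · exact ENNReal.le_of_add_le_add_right (ENNReal.mul_ne_top (by simp) (by simp))
      ((add_le_add_right h₂ _).trans hsum)
  · exact ENNReal.le_of_add_le_add_left (ENNReal.mul_ne_top (by simp) (by simp))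
      ((add_le_add_left h₁ _).trans hsum)

end MonotoneDist

theorem Sminus_eq_neg_Splus (l₁ l₂ t : ℝ) : Sminus l₁ l₂ t = -Splus l₂ l₁ t := by
  unfold Sminus Splus
  split_ifs <;> ring

theorem isSearch_Sminus {l₁ l₂ : ℝ} (hl₁ : 0 < l₁) (hl₂ : 0 < l₂) :
    IsSearch l₁ l₂ (Sminus l₁ l₂) := by
  rw [funext (Sminus_eq_neg_Splus l₁ l₂)]
  exact (isSearch_Splus hl₂ hl₁).neg

theorem arcTime_Splus_le {l₁ l₂ x : ℝ} (hx : x ∈ Ioc 0 l₁) :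
    arcTime (Splus l₁ l₂) x ≤ ENNReal.ofReal x := by
  rw [arcTime_of_nonneg _ hx.1.le]
  exact searchTime_le hx.1.le (by simp [Splus, hx.2])

theorem arcTime_neg_Splus_le {l₁ l₂ y : ℝ} (hl₁ : 0 < l₁) (hy : y ∈ Ioc 0 l₂) :
    arcTime (fun t => -Splus l₁ l₂ t) y ≤ ENNReal.ofReal y + 2 * ENNReal.ofReal l₁ := by
  have e : ENNReal.ofReal y + 2 * ENNReal.ofReal l₁ = ENNReal.ofReal (2 * l₁ + y) := by
    rw [add_comm, ENNReal.ofReal_add (by linarith) hy.1.le, ENNReal.ofReal_mul (by norm_num),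
      ENNReal.ofReal_ofNat]
  rw [arcTime_neg _ hy.1.le, e]
  refine searchTime_le (by linarith [hy.1]) ?_
  rw [Splus, if_neg (by linarith [hy.1]), if_pos (by linarith [hy.2])]
  ring

/-- Integrating the search times of a depth-first search over the arc explored second. -/
theorem setLIntegral_le_of_le_add {l d : ℝ} {ν : Measure ℝ} {c : ℝ≥0∞} {f : ℝ → ℝ≥0∞}
    (hν : ν (Ioc 0 l) ≤ c * ENNReal.ofReal l)
    (hf : ∀ y ∈ Ioc 0 l, f y ≤ ENNReal.ofReal y + 2 * ENNReal.ofReal d) :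
    ∫⁻ y in Ioc 0 l, f y ∂ν ≤ ∫⁻ y in Ioc 0 l, ENNReal.ofReal y ∂ν +
      2 * (c * (ENNReal.ofReal d * ENNReal.ofReal l)) := by
  calc ∫⁻ y in Ioc 0 l, f y ∂ν
      ≤ ∫⁻ y in Ioc 0 l, (ENNReal.ofReal y + 2 * ENNReal.ofReal d) ∂ν :=
        setLIntegral_mono (by fun_prop) hf
    _ = ∫⁻ y in Ioc 0 l, ENNReal.ofReal y ∂ν + 2 * ENNReal.ofReal d * ν (Ioc 0 l) := by
        rw [lintegral_add_right _ measurable_const, setLIntegral_const]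
    _ ≤ ∫⁻ y in Ioc 0 l, ENNReal.ofReal y ∂ν +
          2 * ENNReal.ofReal d * (c * ENNReal.ofReal l) := by gcongr
    _ = _ := by ring

section Optimality

variable {l₁ l₂ : ℝ} {h : Measure ℝ} [IsProbabilityMeasure h]

theorem expTime_Splus_le (hl₁ : 0 < l₁) (hl₂ : 0 < l₂) (hsupp : h (Icc (-l₂) l₁) = 1)
    (hmono : MonotoneDist l₁ l₂ h) :
    expTime (Splus l₁ l₂) h ≤ depthFirstValue l₁ l₂ h := by
  rw [(isSearch_Splus hl₁ hl₂).expTime_eq hl₁ hl₂ hsupp, depthFirstValue, add_assoc]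
  exact add_le_add (setLIntegral_mono (by fun_prop) fun x hx => arcTime_Splus_le hx)
    (setLIntegral_le_of_le_add (hmono.measure_arc_le hl₁ hl₂).2 fun y hy =>
      arcTime_neg_Splus_le hl₁ hy)

theorem expTime_Sminus_le (hl₁ : 0 < l₁) (hl₂ : 0 < l₂) (hsupp : h (Icc (-l₂) l₁) = 1)
    (hmono : MonotoneDist l₁ l₂ h) :
    expTime (Sminus l₁ l₂) h ≤ depthFirstValue l₁ l₂ h := by
  rw [(isSearch_Sminus hl₁ hl₂).expTime_eq hl₁ hl₂ hsupp, depthFirstValue, add_right_comm,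
    mul_comm (ENNReal.ofReal l₁)]
  simp only [funext (Sminus_eq_neg_Splus l₁ l₂), neg_neg]
  exact add_le_add (setLIntegral_le_of_le_add (hmono.measure_arc_le hl₁ hl₂).1 fun x hx =>
    arcTime_neg_Splus_le hl₂ hx) (setLIntegral_mono (by fun_prop) fun y hy => arcTime_Splus_le hy)

/-- A lower bound for the time at which a search finds the point `x` of the positive arc: the
way to `x`, plus twice the part of the negative arc explored before. -/
def arcBound (l₂ : ℝ) (S : ℝ → ℝ) (x : ℝ) : ℝ≥0∞ :=
  ENNReal.ofReal x +
    2 * volume.restrict (Ioc 0 l₂) {y | arcTime (fun t => -S t) y < arcTime S x}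

/-- The analogous lower bound for the point `-y` of the negative arc. -/
def negArcBound (l₁ : ℝ) (S : ℝ → ℝ) (y : ℝ) : ℝ≥0∞ :=
  ENNReal.ofReal y +
    2 * volume.restrict (Ioc 0 l₁) {x | arcTime S x ≤ arcTime (fun t => -S t) y}

variable {S : ℝ → ℝ}

theorem IsSearch.isLowerSet_lt (hS : IsSearch l₁ l₂ S) (x : ℝ) :
    IsLowerSet {y | arcTime (fun t => -S t) y < arcTime S x} := fun _ _ hzy hy =>
  (hS.neg.monotone_arcTime hzy).trans_lt hy

theorem IsSearch.isLowerSet_le (hS : IsSearch l₁ l₂ S) (y : ℝ) :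
    IsLowerSet {x | arcTime S x ≤ arcTime (fun t => -S t) y} := fun _ _ hzx hx =>
  (hS.monotone_arcTime hzx).trans hx

theorem IsSearch.arcBound_le (hS : IsSearch l₁ l₂ S) {x : ℝ} (hx : 0 ≤ x) :
    arcBound l₂ S x ≤ arcTime S x :=
  hS.add_volume_le_arcTime hx (hS.isLowerSet_lt x) fun _ hy => le_of_lt hy

theorem IsSearch.negArcBound_le (hS : IsSearch l₁ l₂ S) {y : ℝ} (hy : 0 ≤ y) :
    negArcBound l₁ S y ≤ arcTime (fun t => -S t) y :=
  hS.add_volume_le_arcTime_neg hy (hS.isLowerSet_le y) fun _ hx => hx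

theorem depthFirstValue_le (hS : IsSearch l₁ l₂ S) (hl₁ : 0 < l₁) (hl₂ : 0 < l₂)
    (hmono : MonotoneDist l₁ l₂ h) :
    depthFirstValue l₁ l₂ h ≤ ∫⁻ x in Ioc 0 l₁, arcBound l₂ S x ∂h +
      ∫⁻ y in Ioc 0 l₂, negArcBound l₁ S y ∂h.map Neg.neg := by
  have key := mul_le_lintegral_add_lintegral
    (fun U hU => hmono.mul_volume_le hl₁ hl₂ (U := U) hU)
    (fun U hU => hmono.mul_volume_le_map_neg hl₁ hl₂ (U := U) hU)
    hS.monotone_arcTime hS.neg.monotone_arcTime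
  simp only [Measure.restrict_apply_univ, Real.volume_Ioc, sub_zero] at key
  simp only [arcBound, negArcBound]
  rw [lintegral_add_left (by fun_prop), lintegral_add_left (by fun_prop),
    lintegral_const_mul' _ _ (by simp), lintegral_const_mul' _ _ (by simp), add_add_add_comm,
    ← mul_add, depthFirstValue]
  gcongr

theorem setLIntegral_arcBound_le (hS : IsSearch l₁ l₂ S) {ν : Measure ℝ} :
    ∫⁻ x in Ioc 0 l₁, arcBound l₂ S x ∂ν ≤ ∫⁻ x in Ioc 0 l₁, arcTime S x ∂ν :=
  setLIntegral_mono hS.monotone_arcTime.measurable fun _ hx => hS.arcBound_le hx.1.le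

theorem setLIntegral_negArcBound_le (hS : IsSearch l₁ l₂ S) {ν : Measure ℝ} :
    ∫⁻ y in Ioc 0 l₂, negArcBound l₁ S y ∂ν ≤
      ∫⁻ y in Ioc 0 l₂, arcTime (fun t => -S t) y ∂ν :=
  setLIntegral_mono hS.neg.monotone_arcTime.measurable fun _ hy => hS.negArcBound_le hy.1.le

theorem depthFirstValue_le_expTime (hS : IsSearch l₁ l₂ S) (hl₁ : 0 < l₁) (hl₂ : 0 < l₂)
    (hsupp : h (Icc (-l₂) l₁) = 1) (hmono : MonotoneDist l₁ l₂ h) :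
    depthFirstValue l₁ l₂ h ≤ expTime S h := by
  rw [hS.expTime_eq hl₁ hl₂ hsupp]
  exact (depthFirstValue_le hS hl₁ hl₂ hmono).trans
    (add_le_add (setLIntegral_arcBound_le hS) (setLIntegral_negArcBound_le hS))

/-- If an integral over an arc is finite and attains a pointwise lower bound, then the bound is
attained at points arbitrarily close to the end of the arc. -/
theorem exists_eq_of_setLIntegral_le {l ε : ℝ} (hεl : ε < l) {ν : Measure ℝ}
    (hν : ν (Icc (l - ε) l) ≠ 0) {f g : ℝ → ℝ≥0∞} (hg : Measurable g)
    (hfg : ∀ x ∈ Ioc 0 l, f x ≤ g x) (hfin : ∫⁻ x in Ioc 0 l, f x ∂ν ≠ ⊤)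
    (hle : ∫⁻ x in Ioc 0 l, g x ∂ν ≤ ∫⁻ x in Ioc 0 l, f x ∂ν) :
    ∃ x ∈ Icc (l - ε) l, g x = f x := by
  have hae := ae_eq_of_ae_le_of_lintegral_le
    ((ae_restrict_iff' measurableSet_Ioc).2 (ae_of_all _ hfg)) hfin hg.aemeasurable hle
  have hfreq : ∃ᵐ x ∂ν, x ∈ Icc (l - ε) l := frequently_ae_iff.2 hν
  obtain ⟨x, hx, hxe⟩ := (hfreq.and_eventually ((ae_restrict_iff' measurableSet_Ioc).1 hae)).exists
  exact ⟨x, hx, (hxe ⟨by linarith [hx.1], hx.2⟩).symm⟩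

/-- An optimal search attains both lower bounds close to the ends of the arcs. -/
theorem exists_eq_bounds (hS : IsSearch l₁ l₂ S) (hl₁ : 0 < l₁) (hl₂ : 0 < l₂)
    (hsupp : h (Icc (-l₂) l₁) = 1) (hmono : MonotoneDist l₁ l₂ h)
    (hopt : expTime S h ≤ depthFirstValue l₁ l₂ h) {ε : ℝ} (hε : 0 < ε) (hε₁ : ε < l₁)
    (hε₂ : ε < l₂) :
    (∃ x ∈ Icc (l₁ - ε) l₁, arcTime S x = arcBound l₂ S x) ∧
      ∃ y ∈ Icc (l₂ - ε) l₂, arcTime (fun t => -S t) y = negArcBound l₁ S y := by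
  have hfin := ne_top_of_le_ne_top (depthFirstValue_ne_top l₁ l₂ h) hopt
  have hle := hopt.trans (depthFirstValue_le hS hl₁ hl₂ hmono)
  rw [hS.expTime_eq hl₁ hl₂ hsupp] at hfin hle
  obtain ⟨hfin₁, hfin₂⟩ := ENNReal.add_ne_top.1 hfin
  have i₁ := setLIntegral_arcBound_le (ν := h) hS
  have i₂ := setLIntegral_negArcBound_le (ν := h.map Neg.neg) hS
  have hf₁ := ne_top_of_le_ne_top hfin₁ i₁
  have hf₂ := ne_top_of_le_ne_top hfin₂ i₂
  have hpos : ∀ l : ℝ, 0 < ENNReal.ofReal (1 / (l₁ + l₂) * (l - (l - ε))) := fun l => by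
    rw [sub_sub_cancel, ENNReal.ofReal_pos]
    positivity
  constructor
  · refine exists_eq_of_setLIntegral_le hε₁ ?_ hS.monotone_arcTime.measurable
      (fun x hx => hS.arcBound_le hx.1.le) hf₁ ?_
    · exact ((hpos l₁).trans_le (hmono.le_measure_Icc _ (by linarith) (by linarith))).ne'
    · exact ENNReal.le_of_add_le_add_right hf₂ ((add_le_add_right i₂ _).trans hle)
  · refine exists_eq_of_setLIntegral_le hε₂ ?_ hS.neg.monotone_arcTime.measurable
      (fun y hy => hS.negArcBound_le hy.1.le) hf₂ ?_
    · exact ((hpos l₂).trans_le (hmono.le_map_neg_measure_Icc _ (by linarith) (by linarith))).ne'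
    · exact ENNReal.le_of_add_le_add_left hf₁ ((add_le_add_left i₁ _).trans hle)

/-- An optimal search goes straight to a turning point near the end of one arc and from there
straight to a point near the end of the other arc. -/
theorem exists_turn_or_exists_turn (hS : IsSearch l₁ l₂ S) (hl₁ : 0 < l₁) (hl₂ : 0 < l₂)
    (hsupp : h (Icc (-l₂) l₁) = 1) (hmono : MonotoneDist l₁ l₂ h)
    (hopt : expTime S h ≤ depthFirstValue l₁ l₂ h) {ε : ℝ} (hε : 0 < ε) (hε₁ : ε < l₁)
    (hε₂ : ε < l₂) :
    (∃ a y, l₁ - ε ≤ a ∧ l₂ - ε ≤ y ∧ S a = a ∧ S (2 * a + y) = -y) ∨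
      ∃ b x, l₂ - ε ≤ b ∧ l₁ - ε ≤ x ∧ -S b = b ∧ -S (2 * b + x) = -x := by
  obtain ⟨⟨x, hx, hxe⟩, y, hy, hye⟩ := exists_eq_bounds hS hl₁ hl₂ hsupp hmono hopt hε hε₁ hε₂
  have hx0 : 0 < x := by linarith [hx.1]
  have hy0 : 0 < y := by linarith [hy.1]
  rcases le_or_gt (arcTime S x) (arcTime (fun t => -S t) y) with hxy | hyx
  · obtain ⟨a, hxa, ha, hay⟩ := hS.exists_turn_of_arcTime_eq ⟨hx0, hx.2⟩ hy0
      (hS.isLowerSet_le y) (fun _ hz => hz) hxy hye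
    exact .inl ⟨a, y, hx.1.trans hxa, hy.1, ha, hay⟩
  · obtain ⟨b, hyb, hb, hbx⟩ := hS.neg.exists_turn_of_arcTime_eq ⟨hy0, hy.2⟩ hx0
      (hS.isLowerSet_lt x) (fun z hz => by simpa using le_of_lt hz) hyx
      (by simp only [neg_neg]; exact hxe)
    exact .inr ⟨b, x, hy.1.trans hyb, hx.1, hb, hbx⟩

theorem eq_Splus_or_eq_Sminus (hS : IsSearch l₁ l₂ S) (hl₁ : 0 < l₁) (hl₂ : 0 < l₂)
    (hsupp : h (Icc (-l₂) l₁) = 1) (hmono : MonotoneDist l₁ l₂ h)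
    (hopt : expTime S h ≤ depthFirstValue l₁ l₂ h) :
    (∀ t ∈ Icc (0 : ℝ) (2 * l₁ + l₂), S t = Splus l₁ l₂ t) ∨
      (∀ t ∈ Icc (0 : ℝ) (2 * l₂ + l₁), S t = Sminus l₁ l₂ t) := by
  obtain ⟨d, hd0, hd₁, hd₂⟩ : ∃ d, 0 < d ∧ 2 * d ≤ l₁ ∧ 2 * d ≤ l₂ :=
    ⟨min l₁ l₂ / 2, by positivity, by linarith [min_le_left l₁ l₂],
      by linarith [min_le_right l₁ l₂]⟩
  have turns : ∀ ε : ℝ, 0 < ε → _ := fun ε hε =>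
    exists_turn_or_exists_turn hS hl₁ hl₂ hsupp hmono hopt (ε := min ε d) (lt_min hε hd0)
      (by linarith [min_le_right ε d]) (by linarith [min_le_right ε d])
  by_cases hSd : S d = d
  · refine .inl (hS.eq_Splus_of_approx hl₁ hl₂ fun ε hε => ?_)
    have hεl := min_le_left ε d
    have hεr := min_le_right ε d
    rcases turns ε hε with ⟨a, y, ha, hy, h₁, h₂⟩ | ⟨b, x, hb, hx, h₁, -⟩
    · exact ⟨a, y, by linarith, by linarith, by linarith, by linarith, h₁, h₂⟩
    · have := hS.neg.apply_eq_of_le h₁ hd0.le (by linarith)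
      linarith
  · right
    have := hS.neg.eq_Splus_of_approx hl₂ hl₁ fun ε hε => ?_
    · intro t ht
      rw [Sminus_eq_neg_Splus, ← this t ht, neg_neg]
    have hεl := min_le_left ε d
    have hεr := min_le_right ε d
    rcases turns ε hε with ⟨a, y, ha, hy, h₁, -⟩ | ⟨b, x, hb, hx, h₁, h₂⟩
    · exact absurd (hS.apply_eq_of_le h₁ hd0.le (by linarith)) hSd
    · exact ⟨b, x, by linarith, by linarith, by linarith, by linarith, h₁, h₂⟩

end Optimality

/-- A monotone hiding distribution is strongly simply searchable: both depth-first
searches are optimal, and every optimal search agrees with one of them until the network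
is covered. -/
theorem monotone_strongly_simply_searchable (l₁ l₂ : ℝ) (hl₁ : 0 < l₁) (hl₂ : 0 < l₂)
    (h : Measure ℝ) [IsProbabilityMeasure h] (hsupp : h (Icc (-l₂) l₁) = 1)
    (hmono : MonotoneDist l₁ l₂ h) :
    (∀ S' : ℝ → ℝ, IsSearch l₁ l₂ S' → expTime (Splus l₁ l₂) h ≤ expTime S' h) ∧
    (∀ S' : ℝ → ℝ, IsSearch l₁ l₂ S' → expTime (Sminus l₁ l₂) h ≤ expTime S' h) ∧
    (∀ S : ℝ → ℝ, IsSearch l₁ l₂ S →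
      (∀ S' : ℝ → ℝ, IsSearch l₁ l₂ S' → expTime S h ≤ expTime S' h) →
      (∀ t ∈ Icc (0 : ℝ) (2 * l₁ + l₂), S t = Splus l₁ l₂ t) ∨
        (∀ t ∈ Icc (0 : ℝ) (2 * l₂ + l₁), S t = Sminus l₁ l₂ t)) := by
  refine ⟨fun S' hS' => ?_, fun S' hS' => ?_, fun S hS hopt => ?_⟩
  · exact (expTime_Splus_le hl₁ hl₂ hsupp hmono).trans
      (depthFirstValue_le_expTime hS' hl₁ hl₂ hsupp hmono)
  · exact (expTime_Sminus_le hl₁ hl₂ hsupp hmono).trans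
      (depthFirstValue_le_expTime hS' hl₁ hl₂ hsupp hmono)
  · exact eq_Splus_or_eq_Sminus hS hl₁ hl₂ hsupp hmono
      ((hopt _ (isSearch_Splus hl₁ hl₂)).trans (expTime_Splus_le hl₁ hl₂ hsupp hmono))

end
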